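/- Let b : ℝ^{2^V} be a linear functional, V a finite set. The inequality Σ_{X ⊆ V} a_X h(X) ≥ 0 holds for all polymatroids h on V if and only if there exist nonnegative coefficients m_μ (for each monotonicity measure μ = (Y|X)) and s_σ (for each submodularity measure σ = (Y;Z|X)) such that Σ_X a_X h(X) = Σ_μ m_μ h(μ) + Σ_σ s_σ h(σ) holds as an identity of linear functionals on the space of set functions h with h(∅) = 0. -/

import Mathlib

def IsPolymatroid {V : Type*} [DecidableEq V] (h : Finset V → ℝ) : Prop :=
  h ∅ = 0 ∧ (∀ A B : Finset V, A ⊆ B → h A ≤ h B) ∧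
    (∀ A B : Finset V, h (A ∪ B) + h (A ∩ B) ≤ h A + h B)

/-- **Farkas' lemma** for finitely many linear functionals: a functional that is nonnegative
wherever all `f i` are nonnegative is a nonnegative combination of the `f i`. -/
theorem exists_nonneg_combination_of_nonneg {E ι : Type*} [AddCommGroup E] [Module ℝ E]
    (t : Finset ι) (f : ι → E →ₗ[ℝ] ℝ) (g : E →ₗ[ℝ] ℝ)
    (hg : ∀ x, (∀ i ∈ t, 0 ≤ f i x) → 0 ≤ g x) :
    ∃ c : ι → ℝ, (∀ i, 0 ≤ c i) ∧ ∀ x, g x = ∑ i ∈ t, c i * f i x := by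
  classical
  induction t using Finset.induction_on generalizing f g with
  | empty =>
    refine ⟨0, fun _ => le_rfl, fun x => ?_⟩
    have h₁ := hg x (by simp)
    have h₂ := hg (-x) (by simp)
    rw [map_neg] at h₂
    rw [Finset.sum_empty]
    linarith
  | insert j t hj ih =>
    have key : ∀ (c : ι → ℝ) (r : ℝ) (x : E),
        ∑ i ∈ insert j t, Function.update c j r i * f i x
          = r * f j x + ∑ i ∈ t, c i * f i x := by
      intro c r x
      rw [Finset.sum_insert hj, Function.update_self]
      congr 1
      refine Finset.sum_congr rfl fun i hi => ?_
      rw [Function.update_of_ne (ne_of_mem_of_not_mem hi hj)]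
    have update_nonneg : ∀ (c : ι → ℝ) (r : ℝ), (∀ i, 0 ≤ c i) → 0 ≤ r →
        ∀ i, 0 ≤ Function.update c j r i := by
      intro c r hc hr i
      rw [Function.update_apply]
      split_ifs
      exacts [hr, hc i]
    by_cases hall : ∀ x, (∀ i ∈ t, 0 ≤ f i x) → 0 ≤ g x
    · obtain ⟨c, hc, hgc⟩ := ih f g hall
      exact ⟨Function.update c j 0, update_nonneg c 0 hc le_rfl,
        fun x => by rw [key, hgc]; ring⟩
    push Not at hall
    obtain ⟨y, hfy, hgy⟩ := hall
    have hjy : f j y < 0 := by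
      by_contra! hcon
      exact hgy.not_ge (hg y (Finset.forall_mem_insert _ _ _ |>.2 ⟨hcon, hfy⟩))
    -- The projection onto the kernel of `f j` along `y` reduces to the functionals in `t`.
    let P : E →ₗ[ℝ] E := LinearMap.id - (f j).smulRight ((f j y)⁻¹ • y)
    have hP : ∀ (φ : E →ₗ[ℝ] ℝ) (x : E), φ (P x) = φ x - f j x * ((f j y)⁻¹ * φ y) := by
      intro φ x
      simp [P]
    obtain ⟨c, hc, hgc⟩ := ih (fun i => f i ∘ₗ P) (g ∘ₗ P) fun x hx => by
      refine hg (P x) (Finset.forall_mem_insert _ _ _ |>.2 ⟨?_, hx⟩)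
      rw [hP, inv_mul_cancel₀ hjy.ne, mul_one, sub_self]
    have hsum : 0 ≤ ∑ i ∈ t, c i * f i y :=
      Finset.sum_nonneg fun i hi => mul_nonneg (hc i) (hfy i hi)
    refine ⟨Function.update c j ((f j y)⁻¹ * (g y - ∑ i ∈ t, c i * f i y)),
      update_nonneg _ _ hc (mul_nonneg_of_nonpos_of_nonpos (inv_nonpos.2 hjy.le)
        (by linarith)), fun x => ?_⟩
    have hx := hgc x
    simp only [LinearMap.comp_apply, hP] at hx
    have hexpand : ∑ i ∈ t, c i * (f i x - f j x * ((f j y)⁻¹ * f i y))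
        = ∑ i ∈ t, c i * f i x - f j x * ((f j y)⁻¹ * ∑ i ∈ t, c i * f i y) := by
      rw [Finset.mul_sum, Finset.mul_sum, ← Finset.sum_sub_distrib]
      exact Finset.sum_congr rfl fun i _ => by ring
    rw [hexpand] at hx
    rw [key]
    linarith

/-- Evaluation of a set function at `S`, as a linear functional. -/
def evalFunctional {V : Type*} (S : Finset V) : (Finset V → ℝ) →ₗ[ℝ] ℝ :=
  LinearMap.proj S

theorem evalFunctional_apply {V : Type*} (S : Finset V) (h : Finset V → ℝ) :
    evalFunctional S h = h S := rfl

/-- The functional `h ↦ h (X ∪ Y) - h X` attached to a pair `(X, Y)`. -/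
def monotonicityFunctional {V : Type*} [DecidableEq V] (μ : Finset V × Finset V) :
    (Finset V → ℝ) →ₗ[ℝ] ℝ :=
  evalFunctional (μ.1 ∪ μ.2) - evalFunctional μ.1

/-- The functional `h ↦ h (X ∪ Y) + h (X ∪ Z) - h X - h (X ∪ Y ∪ Z)` attached to a triple
`(X, Y, Z)`. -/
def submodularityFunctional {V : Type*} [DecidableEq V]
    (σ : Finset V × Finset V × Finset V) : (Finset V → ℝ) →ₗ[ℝ] ℝ :=
  evalFunctional (σ.1 ∪ σ.2.1) + evalFunctional (σ.1 ∪ σ.2.2)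
    - evalFunctional σ.1 - evalFunctional (σ.1 ∪ σ.2.1 ∪ σ.2.2)

theorem monotonicityFunctional_apply {V : Type*} [DecidableEq V] (μ : Finset V × Finset V)
    (h : Finset V → ℝ) : monotonicityFunctional μ h = h (μ.1 ∪ μ.2) - h μ.1 := rfl

theorem submodularityFunctional_apply {V : Type*} [DecidableEq V]
    (σ : Finset V × Finset V × Finset V) (h : Finset V → ℝ) :
    submodularityFunctional σ h
      = h (σ.1 ∪ σ.2.1) + h (σ.1 ∪ σ.2.2) - h σ.1 - h (σ.1 ∪ σ.2.1 ∪ σ.2.2) := rfl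

theorem IsPolymatroid.monotonicityFunctional_nonneg {V : Type*} [DecidableEq V]
    {h : Finset V → ℝ} (hh : IsPolymatroid h) (μ : Finset V × Finset V) :
    0 ≤ monotonicityFunctional μ h :=
  sub_nonneg.2 (hh.2.1 _ _ Finset.subset_union_left)

theorem IsPolymatroid.submodularityFunctional_nonneg {V : Type*} [DecidableEq V]
    {h : Finset V → ℝ} (hh : IsPolymatroid h) (σ : Finset V × Finset V × Finset V)
    (hσ : Disjoint σ.2.1 σ.2.2) : 0 ≤ submodularityFunctional σ h := by
  have hsub := hh.2.2 (σ.1 ∪ σ.2.1) (σ.1 ∪ σ.2.2)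
  rw [← Finset.union_union_distrib_left, ← Finset.union_inter_distrib_left,
    Finset.disjoint_iff_inter_eq_empty.1 hσ, Finset.union_empty, ← Finset.union_assoc] at hsub
  rw [submodularityFunctional_apply]
  linarith

theorem isPolymatroid_of_functionals_nonneg {V : Type*} [DecidableEq V] {h : Finset V → ℝ}
    (h_empty : h ∅ = 0)
    (hmono : ∀ μ : Finset V × Finset V, Disjoint μ.1 μ.2 → 0 ≤ monotonicityFunctional μ h)
    (hsub : ∀ σ : Finset V × Finset V × Finset V,
      Disjoint σ.1 σ.2.1 ∧ Disjoint σ.1 σ.2.2 ∧ Disjoint σ.2.1 σ.2.2 →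
        0 ≤ submodularityFunctional σ h) :
    IsPolymatroid h := by
  refine ⟨h_empty, fun A B hAB => ?_, fun A B => ?_⟩
  · have hle := hmono (A, B \ A) Finset.disjoint_sdiff
    rwa [monotonicityFunctional_apply, Finset.union_sdiff_of_subset hAB, sub_nonneg] at hle
  · have hle := hsub (A ∩ B, A \ B, B \ A)
      ⟨by grind [Finset.disjoint_left], by grind [Finset.disjoint_left],
        by grind [Finset.disjoint_left]⟩
    have hA : A ∩ B ∪ A \ B = A := by grind
    have hB : A ∩ B ∪ B \ A = B := by grind
    have hAB : A ∪ B \ A = A ∪ B := by grind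
    rw [submodularityFunctional_apply] at hle
    simp only [hA, hB, hAB] at hle
    linarith

/-- Farkas-type characterization of Shannon inequalities.  A monotonicity measure
`μ = (Y|X)` is a pair `(X, Y)` of disjoint sets with value `h (X ∪ Y) - h X`;
a submodularity measure `σ = (Y;Z|X)` is a triple `(X, Y, Z)` of pairwise disjoint
sets with value `h (X ∪ Y) + h (X ∪ Z) - h X - h (X ∪ Y ∪ Z)`. -/
theorem stmt_18 {V : Type*} [Fintype V] [DecidableEq V] (a : Finset V → ℝ) :
    (∀ h : Finset V → ℝ, IsPolymatroid h → 0 ≤ ∑ S : Finset V, a S * h S) ↔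
    ∃ (m : Finset V × Finset V → ℝ) (s : Finset V × Finset V × Finset V → ℝ),
      (∀ μ, 0 ≤ m μ) ∧ (∀ σ, 0 ≤ s σ) ∧
      ∀ h : Finset V → ℝ, h ∅ = 0 →
        ∑ S : Finset V, a S * h S =
          (∑ μ ∈ Finset.univ.filter (fun μ : Finset V × Finset V => Disjoint μ.1 μ.2),
            m μ * (h (μ.1 ∪ μ.2) - h μ.1)) +
          (∑ σ ∈ Finset.univ.filter (fun σ : Finset V × Finset V × Finset V =>
              Disjoint σ.1 σ.2.1 ∧ Disjoint σ.1 σ.2.2 ∧ Disjoint σ.2.1 σ.2.2),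
            s σ * (h (σ.1 ∪ σ.2.1) + h (σ.1 ∪ σ.2.2) - h σ.1 - h (σ.1 ∪ σ.2.1 ∪ σ.2.2))) := by
  constructor
  · intro ha
    let g : (Finset V → ℝ) →ₗ[ℝ] ℝ :=
      ∑ S : Finset V, a S • (evalFunctional S - evalFunctional ∅)
    have hg : ∀ h, g h = ∑ S : Finset V, a S * (h S - h ∅) := by
      intro h
      simp [g, evalFunctional_apply]
    obtain ⟨c, hc, hgc⟩ := exists_nonneg_combination_of_nonneg
      ((Finset.univ.filter fun μ : Finset V × Finset V => Disjoint μ.1 μ.2).disjSum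
        (Finset.univ.filter fun σ : Finset V × Finset V × Finset V =>
          Disjoint σ.1 σ.2.1 ∧ Disjoint σ.1 σ.2.2 ∧ Disjoint σ.2.1 σ.2.2))
      (Sum.elim monotonicityFunctional submodularityFunctional) g (by
        intro h hh
        rw [hg]
        refine ha (fun S => h S - h ∅) (isPolymatroid_of_functionals_nonneg (sub_self _)
          (fun μ hμ => ?_) fun σ hσ => ?_)
        · have hle := hh (Sum.inl μ) (by simpa using hμ)
          rw [Sum.elim_inl, monotonicityFunctional_apply] at hle
          rw [monotonicityFunctional_apply]
          linarith
        · have hle := hh (Sum.inr σ) (by simpa using hσ)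
          rw [Sum.elim_inr, submodularityFunctional_apply] at hle
          rw [submodularityFunctional_apply]
          linarith)
    refine ⟨c ∘ Sum.inl, c ∘ Sum.inr, fun _ => hc _, fun _ => hc _, fun h h_empty => ?_⟩
    have hh := hgc h
    rw [hg, Finset.sum_disjSum] at hh
    simpa only [Function.comp_apply, h_empty, sub_zero, Sum.elim_inl, Sum.elim_inr,
      monotonicityFunctional_apply, submodularityFunctional_apply] using hh
  · rintro ⟨m, s, hm, hs, heq⟩ h hh
    rw [heq h hh.1]
    exact add_nonneg
      (Finset.sum_nonneg fun μ _ => mul_nonneg (hm μ) (hh.monotonicityFunctional_nonneg μ))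
      (Finset.sum_nonneg fun σ hσ => mul_nonneg (hs σ)
        (hh.submodularityFunctional_nonneg σ (Finset.mem_filter.1 hσ).2.2.2))
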